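/- For every j ∈ (1/2)ℤ the Virasoro operators on ℱ satisfy [L_n^{(j)}, L_m^{(j)}] = (n − m) L_{n+m}^{(j)} − (1/6)(6j² − 6j + 1)(n³ − n) δ_{n+m,0}·id for all n, m ∈ ℤ; that is, the L_n^{(j)} form a representation of the Virasoro algebra with central charge c = −2(6j² − 6j + 1). -/

import Mathlib

/-!
Fermion Fock space, following J.E. Andersen & K. Ueno,
"Abelian Conformal Field Theory and Determinant Bundles".

Encoding conventions:
* The integer `a : ℤ` encodes the half integer `a + 1/2 ∈ 𝐙_h`.
* A Maya diagram is encoded by its set of entries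
  `S = {a : ℤ | ē_{a + 1/2} occurs in the semi-infinite wedge}`;
  such a set contains all sufficiently negative integers and no sufficiently
  positive ones.  This is equivalent to the description via the strictly
  increasing characteristic function `μ` (namely `S` is the image of `μ`,
  shifted by `-1/2`).
-/

noncomputable section
open scoped Classical

namespace AbCFT

/-- The predicate describing (the entry sets of) Maya diagrams. -/
def IsMayaSet (S : Set ℤ) : Prop :=
  (∃ n₀ : ℤ, ∀ a : ℤ, a < n₀ → a ∈ S) ∧ (∃ n₁ : ℤ, ∀ a : ℤ, n₁ ≤ a → a ∉ S)

/-- A Maya diagram (of arbitrary charge), encoded by its set of entries. -/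
def Maya : Type := {S : Set ℤ // IsMayaSet S}

lemma IsMayaSet.erase {S : Set ℤ} (h : IsMayaSet S) (a : ℤ) : IsMayaSet (S \ {a}) := by
  obtain ⟨⟨n₀, h₀⟩, n₁, h₁⟩ := h
  constructor
  · refine ⟨min n₀ a, fun b hb => ⟨h₀ b (by omega), ?_⟩⟩
    simp only [Set.mem_singleton_iff]
    omega
  · exact ⟨n₁, fun b hb hb' => h₁ b hb hb'.1⟩

lemma IsMayaSet.insert {S : Set ℤ} (h : IsMayaSet S) (a : ℤ) : IsMayaSet (insert a S) := by
  obtain ⟨⟨n₀, h₀⟩, n₁, h₁⟩ := h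
  constructor
  · exact ⟨n₀, fun b hb => Set.mem_insert_of_mem _ (h₀ b hb)⟩
  · refine ⟨max n₁ (a + 1), fun b hb hb' => ?_⟩
    rcases hb' with rfl | hb'
    · have : b + 1 ≤ b := le_trans (le_max_right n₁ (b + 1)) hb
      omega
    · exact h₁ b (le_trans (le_max_left _ _) hb) hb'

/-- The dual fermion Fock space `ℱ = ⊕ₚ ℱ(p)`: the free `ℂ`-vector space on the
set of all Maya diagrams. -/
abbrev FockF : Type := Maya →₀ ℂ

/-- The basis vector `|M⟩` of `ℱ`. -/
def ket (m : Maya) : FockF := Finsupp.single m 1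

/-- The number of entries of `S` lying (strictly) above `a`; this governs the
Koszul signs of the fermion operators. -/
def cntAbove (S : Set ℤ) (a : ℤ) : ℕ := {b : ℤ | b ∈ S ∧ a < b}.ncard

/-- Removing an entry from a Maya diagram. -/
def mayaErase (m : Maya) (a : ℤ) : Maya := ⟨m.1 \ {a}, m.2.erase a⟩

/-- Inserting an entry into a Maya diagram. -/
def mayaInsert (m : Maya) (a : ℤ) : Maya := ⟨insert a m.1, m.2.insert a⟩

/-- `ψ_{a+1/2} |M⟩`: the interior product `i(ē_{a+1/2})`, deleting the factor
`ē_{a+1/2}` with its Koszul sign. -/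
def psiKet (a : ℤ) (m : Maya) : FockF :=
  if a ∈ m.1 then ((-1 : ℂ) ^ cntAbove m.1 a) • ket (mayaErase m a) else 0

/-- `ψ̄_{a+1/2} |M⟩`: exterior multiplication `ē_{-(a+1/2)} ∧ ·` in front,
with its Koszul sign. -/
def psibarKet (a : ℤ) (m : Maya) : FockF :=
  if (-a - 1) ∈ m.1 then 0
  else ((-1 : ℂ) ^ cntAbove m.1 (-a - 1)) • ket (mayaInsert m (-a - 1))

/-- The fermion operator `ψ_ν` (for `ν = a + 1/2`) acting on `ℱ` from the left. -/
def psi (a : ℤ) : FockF →ₗ[ℂ] FockF := Finsupp.linearCombination ℂ (psiKet a)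

/-- The fermion operator `ψ̄_ν` (for `ν = a + 1/2`) acting on `ℱ` from the left. -/
def psibar (a : ℤ) : FockF →ₗ[ℂ] FockF := Finsupp.linearCombination ℂ (psibarKet a)

/-- The charge of a Maya diagram. -/
def charge (m : Maya) : ℤ :=
  ({b : ℤ | b ∈ m.1 ∧ 0 ≤ b}.ncard : ℤ) - ({b : ℤ | b < 0 ∧ b ∉ m.1}.ncard : ℤ)

/-- The degree `d(M) = Σ_ν (μ(ν) - ν)` of a Maya diagram, expressed in terms of
the entry set. -/
def degree (m : Maya) : ℤ :=
  (∑ᶠ b ∈ {b : ℤ | b ∈ m.1 ∧ 0 ≤ b}, (b + 1)) +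
    (∑ᶠ b ∈ {b : ℤ | b < 0 ∧ b ∉ m.1}, (-b - 1)) -
    charge m * (charge m + 1) / 2

/-- The vacuum Maya diagram of charge `p`:  `|p⟩ = ē_{p-1/2} ∧ ē_{p-3/2} ∧ ⋯`. -/
def vacMaya (p : ℤ) : Maya :=
  ⟨{a : ℤ | a < p}, ⟨p, fun _ ha => ha⟩, ⟨p, fun a ha h => by
    simp only [Set.mem_setOf_eq] at h; omega⟩⟩

/-- The vacuum vector `|p⟩ ∈ ℱ(p)`. -/
def ketVac (p : ℤ) : FockF := ket (vacMaya p)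

/-- The charge-`p` summand `ℱ(p) ⊆ ℱ`. -/
def Fcharge (p : ℤ) : Submodule ℂ FockF :=
  Submodule.span ℂ (ket '' {m : Maya | charge m = p})

/-- The graded piece `ℱ_d(p) ⊆ ℱ(p)` spanned by the Maya diagrams of charge `p`
and degree `d` (it is `0` when `d < 0`). -/
def Fgraded (d p : ℤ) : Submodule ℂ FockF :=
  Submodule.span ℂ (ket '' {m : Maya | charge m = p ∧ degree m = d})

/-- `j` is an integer or half integer, i.e. `j ∈ (1/2)ℤ`. -/
def IsHalfIntegral (j : ℚ) : Prop := ∃ k : ℤ, j = (k : ℚ) / 2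

/-- The summand `((1-j)(ν-n-1/2) + j(ν+1/2)) :ψ_{n-ν} ψ̄_ν:` (with `ν = a + 1/2`)
of the Virasoro operator `L_n^{(j)}`. -/
def lterm (j : ℚ) (n a : ℤ) : FockF →ₗ[ℂ] FockF :=
  (((1 - j) * ((a : ℚ) - (n : ℚ)) + j * ((a : ℚ) + 1) : ℚ) : ℂ) •
    (if a < 0 ∧ 0 ≤ n - a - 1 then -(psibar a ∘ₗ psi (n - a - 1))
     else psi (n - a - 1) ∘ₗ psibar a)

/-- The Virasoro operator `L_n^{(j)}` on `ℱ` (a locally finite sum, defined on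
basis vectors and extended linearly). -/
def Lop (j : ℚ) (n : ℤ) : FockF →ₗ[ℂ] FockF :=
  Finsupp.linearCombination ℂ (fun m => ∑ᶠ a : ℤ, lterm j n a (ket m))

/-! ### Koszul signs -/

lemma Maya.finite_above (m : Maya) (a : ℤ) : {b : ℤ | b ∈ m.1 ∧ a < b}.Finite := by
  obtain ⟨n₁, h₁⟩ := m.2.2
  refine (Set.finite_Ioo a n₁).subset fun b hb => ⟨hb.2, ?_⟩
  by_contra! h
  exact h₁ b h hb.1

/-- The Koszul sign of the entry `a` relative to the Maya diagram `m`. -/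
def koszul (m : Maya) (a : ℤ) : ℂ := (-1) ^ cntAbove m.1 a

lemma koszul_mul_self (m : Maya) (a : ℤ) : koszul m a * koszul m a = 1 := by
  rw [koszul, ← mul_pow]
  norm_num

lemma koszul_erase (m : Maya) {b : ℤ} (hb : b ∈ m.1) (a : ℤ) :
    koszul (mayaErase m b) a = if a < b then -koszul m a else koszul m a := by
  unfold koszul cntAbove
  split_ifs with h
  · have key : {c : ℤ | c ∈ (mayaErase m b).1 ∧ a < c} = {c : ℤ | c ∈ m.1 ∧ a < c} \ {b} := by
      ext c
      simp only [mayaErase, Set.mem_ofPred_eq, Set.mem_sdiff, Set.mem_singleton_iff]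
      tauto
    have hcard := Set.ncard_sdiff_singleton_add_one
      (show b ∈ {c : ℤ | c ∈ m.1 ∧ a < c} from ⟨hb, h⟩) (m.finite_above a)
    rw [key, ← hcard, pow_succ]
    ring
  · have key : {c : ℤ | c ∈ (mayaErase m b).1 ∧ a < c} = {c : ℤ | c ∈ m.1 ∧ a < c} := by
      ext c
      simp only [mayaErase, Set.mem_ofPred_eq, Set.mem_sdiff, Set.mem_singleton_iff]
      constructor
      · tauto
      · rintro ⟨hc, hac⟩
        exact ⟨⟨hc, by rintro rfl; exact h hac⟩, hac⟩
    rw [key]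

lemma mayaErase_insert {m : Maya} {b : ℤ} (hb : b ∉ m.1) : mayaErase (mayaInsert m b) b = m :=
  Subtype.ext (Set.insert_sdiff_self_of_notMem hb)

lemma mayaInsert_erase {m : Maya} {b : ℤ} (hb : b ∈ m.1) : mayaInsert (mayaErase m b) b = m :=
  Subtype.ext (Set.insert_sdiff_self_of_mem hb)

lemma koszul_insert (m : Maya) {b : ℤ} (hb : b ∉ m.1) (a : ℤ) :
    koszul (mayaInsert m b) a = if a < b then -koszul m a else koszul m a := by
  have h := koszul_erase (mayaInsert m b) (Set.mem_insert b m.1) a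
  rw [mayaErase_insert hb] at h
  rw [h]
  split_ifs <;> ring

lemma mem_mayaErase {m : Maya} {a b : ℤ} : a ∈ (mayaErase m b).1 ↔ a ∈ m.1 ∧ a ≠ b := Iff.rfl

lemma mem_mayaInsert {m : Maya} {a b : ℤ} : a ∈ (mayaInsert m b).1 ↔ a = b ∨ a ∈ m.1 := Iff.rfl

/-! ### Fermion operators on basis vectors and the anticommutation relations -/

lemma psi_ket (a : ℤ) (m : Maya) :
    psi a (ket m) = if a ∈ m.1 then koszul m a • ket (mayaErase m a) else 0 := by
  simp only [psi, ket, Finsupp.linearCombination_single, one_smul, psiKet, koszul]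

lemma psibar_ket (a : ℤ) (m : Maya) :
    psibar a (ket m) =
      if -a - 1 ∈ m.1 then 0 else koszul m (-a - 1) • ket (mayaInsert m (-a - 1)) := by
  simp only [psibar, ket, Finsupp.linearCombination_single, one_smul, psibarKet, koszul]

lemma psi_ket_of_notMem {a : ℤ} {m : Maya} (h : a ∉ m.1) : psi a (ket m) = 0 := by
  rw [psi_ket, if_neg h]

lemma psibar_ket_of_mem {a : ℤ} {m : Maya} (h : -a - 1 ∈ m.1) : psibar a (ket m) = 0 := by
  rw [psibar_ket, if_pos h]

lemma fock_hom_ext {V : Type*} [AddCommGroup V] [Module ℂ V] {f g : FockF →ₗ[ℂ] V}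
    (h : ∀ m, f (ket m) = g (ket m)) : f = g :=
  Finsupp.lhom_ext' fun m => LinearMap.ext_ring (h m)

lemma psi_psi (a b : ℤ) (v : FockF) : psi a (psi b v) = -psi b (psi a v) := by
  suffices H : psi a ∘ₗ psi b = -(psi b ∘ₗ psi a) from LinearMap.congr_fun H v
  refine fock_hom_ext fun m => ?_
  simp only [LinearMap.comp_apply, LinearMap.neg_apply]
  rcases eq_or_ne a b with rfl | hab
  · have : psi a (psi a (ket m)) = 0 := by
      rw [psi_ket]
      split_ifs
      · rw [map_smul, psi_ket_of_notMem (fun h => (mem_mayaErase.1 h).2 rfl), smul_zero]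
      · exact map_zero _
    rw [this, neg_zero]
  by_cases ha : a ∈ m.1 <;> by_cases hb : b ∈ m.1
  · have hcomm : mayaErase (mayaErase m a) b = mayaErase (mayaErase m b) a :=
      Subtype.ext (by ext; simp only [mem_mayaErase]; tauto)
    rw [psi_ket b, if_pos hb, psi_ket a, if_pos ha, map_smul, map_smul, psi_ket, psi_ket,
      if_pos (mem_mayaErase.2 ⟨ha, hab⟩), if_pos (mem_mayaErase.2 ⟨hb, hab.symm⟩), hcomm,
      koszul_erase m hb, koszul_erase m ha, smul_smul, smul_smul, ← neg_smul]
    congr 1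
    rcases hab.lt_or_gt with h | h <;> simp only [h, h.not_gt, if_true, if_false] <;> ring
  all_goals simp [psi_ket, ha, hb, mem_mayaErase]

lemma psibar_psibar (a b : ℤ) (v : FockF) : psibar a (psibar b v) = -psibar b (psibar a v) := by
  suffices H : psibar a ∘ₗ psibar b = -(psibar b ∘ₗ psibar a) from LinearMap.congr_fun H v
  refine fock_hom_ext fun m => ?_
  simp only [LinearMap.comp_apply, LinearMap.neg_apply]
  rcases eq_or_ne a b with rfl | hab
  · have : psibar a (psibar a (ket m)) = 0 := by
      rw [psibar_ket]
      split_ifs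
      · exact map_zero _
      · rw [map_smul, psibar_ket_of_mem (mem_mayaInsert.2 (Or.inl rfl)), smul_zero]
    rw [this, neg_zero]
  have hab' : -a - 1 ≠ -b - 1 := by omega
  by_cases ha : -a - 1 ∈ m.1 <;> by_cases hb : -b - 1 ∈ m.1
  on_goal 4 =>
    have hcomm : mayaInsert (mayaInsert m (-a - 1)) (-b - 1) =
        mayaInsert (mayaInsert m (-b - 1)) (-a - 1) :=
      Subtype.ext (by ext; simp only [mem_mayaInsert]; tauto)
    rw [psibar_ket b, if_neg hb, psibar_ket a, if_neg ha, map_smul, map_smul, psibar_ket,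
      psibar_ket, if_neg (by simp only [mem_mayaInsert]; tauto),
      if_neg (by simp only [mem_mayaInsert]; tauto), hcomm,
      koszul_insert m hb, koszul_insert m ha, smul_smul, smul_smul, ← neg_smul]
    congr 1
    rcases hab'.lt_or_gt with h | h <;> simp only [h, h.not_gt, if_true, if_false] <;> ring
  all_goals simp [psibar_ket, ha, hb, mem_mayaInsert]

lemma psibar_psi_ket_self (a : ℤ) (m : Maya) :
    psibar (-a - 1) (psi a (ket m)) = if a ∈ m.1 then ket m else 0 := by
  have e : -(-a - 1) - 1 = a := by ring
  rw [psi_ket]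
  split_ifs with h
  · rw [map_smul, psibar_ket, e, if_neg (fun h => (mem_mayaErase.1 h).2 rfl), mayaInsert_erase h,
      koszul_erase m h, if_neg (lt_irrefl a), smul_smul, koszul_mul_self, one_smul]
  · exact map_zero _

lemma psi_psibar_ket_self (a : ℤ) (m : Maya) :
    psi a (psibar (-a - 1) (ket m)) = if a ∈ m.1 then 0 else ket m := by
  have e : -(-a - 1) - 1 = a := by ring
  rw [psibar_ket, e]
  split_ifs with h
  · exact map_zero _
  · rw [map_smul, psi_ket, if_pos (mem_mayaInsert.2 (Or.inl rfl)), mayaErase_insert h,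
      koszul_insert m h, if_neg (lt_irrefl a), smul_smul, koszul_mul_self, one_smul]

lemma psi_psibar (a b : ℤ) (v : FockF) :
    psi a (psibar b v) = (if a + b + 1 = 0 then v else 0) - psibar b (psi a v) := by
  suffices H : psi a ∘ₗ psibar b =
      (if a + b + 1 = 0 then LinearMap.id else 0) - psibar b ∘ₗ psi a by
    have := LinearMap.congr_fun H v
    simp only [LinearMap.comp_apply, LinearMap.sub_apply] at this
    rw [this]
    split_ifs <;> rfl
  refine fock_hom_ext fun m => ?_
  simp only [LinearMap.comp_apply, LinearMap.sub_apply]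
  by_cases hab : a + b + 1 = 0
  · obtain rfl : b = -a - 1 := by omega
    rw [psi_psibar_ket_self, psibar_psi_ket_self, if_pos hab]
    split_ifs <;> simp
  have hab' : a ≠ -b - 1 := by omega
  rw [if_neg hab, LinearMap.zero_apply, zero_sub]
  by_cases ha : a ∈ m.1 <;> by_cases hb : -b - 1 ∈ m.1
  on_goal 2 =>
    have hcomm : mayaInsert (mayaErase m a) (-b - 1) = mayaErase (mayaInsert m (-b - 1)) a := by
      refine Subtype.ext ?_
      ext c
      simp only [mem_mayaInsert, mem_mayaErase]
      constructor
      · rintro (rfl | h)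
        · exact ⟨Or.inl rfl, hab'.symm⟩
        · exact ⟨Or.inr h.1, h.2⟩
      · tauto
    rw [psibar_ket b, if_neg hb, psi_ket a, if_pos ha, map_smul, map_smul, psibar_ket,
      psi_ket, if_pos (mem_mayaInsert.2 (Or.inr ha)),
      if_neg (fun h => hb (mem_mayaErase.1 h).1), hcomm,
      koszul_insert m hb, koszul_erase m ha, smul_smul, smul_smul, ← neg_smul]
    congr 1
    rcases hab'.lt_or_gt with h | h <;> simp only [h, h.not_gt, if_true, if_false] <;> ring
  all_goals simp [psibar_ket, psi_ket, ha, hb, mem_mayaInsert, mem_mayaErase, hab', hab'.symm]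

/-! ### The Virasoro operators as locally finite sums -/

/-- The coefficient of `:ψ_{n-ν} ψ̄_ν:` in `L_n^{(j)}`, for `ν = a + 1/2`. -/
def lcoeff (j : ℚ) (n a : ℤ) : ℂ := (1 - j) * (a - n) + j * (a + 1)

lemma lterm_apply (j : ℚ) (n a : ℤ) (v : FockF) :
    lterm j n a v = lcoeff j n a •
      (if a < 0 ∧ 0 ≤ n - a - 1 then -psibar a (psi (n - a - 1) v)
       else psi (n - a - 1) (psibar a v)) := by
  have h : (((1 - j) * ((a : ℚ) - (n : ℚ)) + j * ((a : ℚ) + 1) : ℚ) : ℂ) = lcoeff j n a := by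
    simp [lcoeff]
  rw [lterm, h, LinearMap.smul_apply]
  split_ifs <;> rfl

lemma lterm_apply_eq_sub (j : ℚ) (n a : ℤ) (v : FockF) :
    lterm j n a v = lcoeff j n a •
      (psi (n - a - 1) (psibar a v) - if n = 0 ∧ a < 0 then v else 0) := by
  rw [lterm_apply]
  congr 1
  by_cases h : a < 0 ∧ 0 ≤ n - a - 1
  · rw [if_pos h, psi_psibar]
    by_cases hn : n = 0
    · rw [if_pos (by omega), if_pos ⟨hn, h.1⟩]
      abel
    · rw [if_neg (by omega), if_neg (by omega)]
      abel
  · rw [if_neg h, if_neg (by omega), sub_zero]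

lemma lterm_ket_support_finite (j : ℚ) (n : ℤ) (m : Maya) :
    (Function.support fun a => lterm j n a (ket m)).Finite := by
  obtain ⟨⟨n₀, h₀⟩, n₁, h₁⟩ := m.2
  refine (Set.finite_Icc (min (-1) (min (n - 1) (n - 1 - n₁))) (max 0 (-n₀))).subset fun a ha => ?_
  by_contra hmem
  refine ha ?_
  change lterm j n a (ket m) = 0
  rw [Set.mem_Icc] at hmem
  rw [lterm_apply]
  by_cases h : a < min (-1) (min (n - 1) (n - 1 - n₁))
  · rw [if_pos (by omega), psi_ket_of_notMem (h₁ _ (by omega)), map_zero, neg_zero, smul_zero]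
  · rw [if_neg (by omega), psibar_ket_of_mem (h₀ _ (by omega)), map_zero, smul_zero]

lemma lterm_support_finite (j : ℚ) (n : ℤ) (v : FockF) :
    (Function.support fun a => lterm j n a v).Finite := by
  induction v using Finsupp.induction_linear with
  | zero => simp
  | add f g hf hg =>
    simp only [map_add]
    exact (hf.union hg).subset (Function.support_add _ _)
  | single m c =>
    have e : Finsupp.single m c = c • ket m := by simp [ket]
    simp only [e, map_smul]
    exact (lterm_ket_support_finite j n m).subset
      (Function.support_const_smul_subset c fun a => lterm j n a (ket m))

lemma Lop_apply (j : ℚ) (n : ℤ) (v : FockF) : Lop j n v = ∑ᶠ a : ℤ, lterm j n a v := by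
  induction v using Finsupp.induction_linear with
  | zero => simp
  | add f g hf hg =>
    simp only [map_add, hf, hg]
    exact (finsum_add_distrib (lterm_support_finite j n f) (lterm_support_finite j n g)).symm
  | single m c =>
    have e : Finsupp.single m c = c • ket m := by simp [ket]
    simp only [e, map_smul]
    rw [← smul_finsum' c (lterm_ket_support_finite j n m)]
    simp [Lop, ket]

/-- A linear operator whose commutators with all the `lterm j n a` vanish except for `a = a₀`
has that exceptional commutator as its commutator with `Lop j n`. -/
lemma Lop_comm_of_lterm_comm {j : ℚ} {n : ℤ} (T : FockF →ₗ[ℂ] FockF) (a₀ : ℤ) (v w : FockF)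
    (h : ∀ a, lterm j n a (T v) = T (lterm j n a v) + if a = a₀ then w else 0) :
    Lop j n (T v) = T (Lop j n v) + w := by
  have hfin : (Function.support fun a => T (lterm j n a v)).Finite :=
    (lterm_support_finite j n v).subset fun a ha h0 => ha (by simp only at h0 ⊢; rw [h0, map_zero])
  have hfin' : (Function.support fun a : ℤ => if a = a₀ then w else 0).Finite :=
    (Set.finite_singleton a₀).subset fun a ha => by
      by_contra h0
      exact ha (if_neg h0)
  rw [Lop_apply, Lop_apply, finsum_congr h, finsum_add_distrib hfin hfin', finsum_eq_single _ a₀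
    (fun a ha => if_neg ha), if_pos rfl]
  congr 1
  exact (T.toAddMonoidHom.map_finsum (lterm_support_finite j n v)).symm

lemma Lop_psibar (j : ℚ) (n b : ℤ) (v : FockF) :
    Lop j n (psibar b v) =
      psibar b (Lop j n v) - lcoeff j n (n + b) • psibar (n + b) v := by
  rw [sub_eq_add_neg]
  refine Lop_comm_of_lterm_comm _ (n + b) v _ fun a => ?_
  have key : psibar b (psi (n - a - 1) (psibar a v)) =
      (if a = n + b then psibar a v else 0) + psi (n - a - 1) (psibar a (psibar b v)) := by
    rw [psibar_psibar a b, map_neg, psi_psibar (n - a - 1) b, ← sub_eq_add_neg]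
    by_cases h : a = n + b
    · rw [if_pos h, if_pos (by omega)]
      abel
    · rw [if_neg h, if_neg (by omega)]
      abel
  rw [lterm_apply_eq_sub, lterm_apply_eq_sub, map_smul, map_sub, key, apply_ite (psibar b), map_zero]
  by_cases h : a = n + b
  · subst h
    simp only [if_true]
    module
  · simp only [if_neg h]
    module

lemma Lop_psi (j : ℚ) (n b : ℤ) (v : FockF) :
    Lop j n (psi b v) =
      psi b (Lop j n v) + lcoeff j n (-b - 1) • psi (n + b) v := by
  refine Lop_comm_of_lterm_comm _ (-b - 1) v _ fun a => ?_
  have key : psi b (psi (n - a - 1) (psibar a v)) =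
      psi (n - a - 1) (psibar a (psi b v)) - if a = -b - 1 then psi (n - a - 1) v else 0 := by
    rw [psi_psi b, psi_psibar b a, map_sub]
    by_cases h : a = -b - 1
    · rw [if_pos h, if_pos (by omega)]
      abel
    · rw [if_neg h, if_neg (by omega), map_zero]
      abel
  rw [lterm_apply_eq_sub, lterm_apply_eq_sub, map_smul, map_sub, key, apply_ite (psi b), map_zero]
  by_cases h : a = -b - 1
  · subst h
    simp only [if_true, show n - (-b - 1) - 1 = n + b by ring]
    module
  · simp only [if_neg h]
    module

/-! ### The vacuum -/

lemma mem_vacMaya_zero {a : ℤ} : a ∈ (vacMaya 0).1 ↔ a < 0 := Iff.rfl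

lemma psi_ketVac {a : ℤ} (h : 0 ≤ a) : psi a (ketVac 0) = 0 :=
  psi_ket_of_notMem (by rw [mem_vacMaya_zero]; omega)

lemma psibar_ketVac {a : ℤ} (h : 0 ≤ a) : psibar a (ketVac 0) = 0 :=
  psibar_ket_of_mem (by rw [mem_vacMaya_zero]; omega)

/-- The coefficient functional of the vacuum of charge `0`. -/
def vacCoeff : FockF →ₗ[ℂ] ℂ := Finsupp.lapply (vacMaya 0)

lemma vacCoeff_ket (m : Maya) : vacCoeff (ket m) = if m = vacMaya 0 then 1 else 0 := by
  simp [vacCoeff, ket, Finsupp.single_apply]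

lemma vacCoeff_psi {a : ℤ} (h : a < 0) (v : FockF) : vacCoeff (psi a v) = 0 := by
  suffices H : vacCoeff ∘ₗ psi a = 0 from LinearMap.congr_fun H v
  refine fock_hom_ext fun m => ?_
  rw [LinearMap.comp_apply, psi_ket, LinearMap.zero_apply]
  split_ifs
  · rw [map_smul, vacCoeff_ket, if_neg, smul_zero]
    intro e
    exact (mem_mayaErase.1 (e ▸ mem_vacMaya_zero.2 h : a ∈ (mayaErase m a).1)).2 rfl
  · exact map_zero _

lemma vacCoeff_psibar {a : ℤ} (h : a < 0) (v : FockF) : vacCoeff (psibar a v) = 0 := by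
  suffices H : vacCoeff ∘ₗ psibar a = 0 from LinearMap.congr_fun H v
  refine fock_hom_ext fun m => ?_
  rw [LinearMap.comp_apply, psibar_ket, LinearMap.zero_apply]
  split_ifs
  · exact map_zero _
  · rw [map_smul, vacCoeff_ket, if_neg, smul_zero]
    intro e
    have hmem : -a - 1 ∈ (mayaInsert m (-a - 1)).1 := mem_mayaInsert.2 (Or.inl rfl)
    rw [e, mem_vacMaya_zero] at hmem
    omega

lemma Maya.eq_vacMaya_zero_or (m : Maya) :
    m = vacMaya 0 ∨ (∃ k, 0 ≤ k ∧ k ∈ m.1) ∨ ∃ k < 0, k ∉ m.1 := by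
  by_contra! h
  refine h.1 (Subtype.ext (Set.ext fun k => ?_))
  rw [mem_vacMaya_zero]
  refine ⟨fun hk => ?_, h.2.2 k⟩
  by_contra! h0
  exact h.2.1 k h0 hk

lemma psibar_psi_self_apply (k : ℤ) (v : FockF) (m : Maya) :
    psibar (-k - 1) (psi k v) m = if k ∈ m.1 then v m else 0 := by
  suffices H : Finsupp.lapply m ∘ₗ psibar (-k - 1) ∘ₗ psi k =
      (if k ∈ m.1 then Finsupp.lapply m else 0 : FockF →ₗ[ℂ] ℂ) by
    have := LinearMap.congr_fun H v
    split_ifs with h <;> simpa [h] using this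
  refine fock_hom_ext fun m' => ?_
  rw [LinearMap.comp_apply, LinearMap.comp_apply, psibar_psi_ket_self]
  rcases eq_or_ne m' m with rfl | hne
  · split_ifs <;> simp
  · split_ifs <;> simp [ket, hne]

/-- A vector annihilated by all annihilation operators is a multiple of the vacuum. -/
lemma eq_smul_ketVac {v : FockF} (h : ∀ k, 0 ≤ k → psi k v = 0)
    (h' : ∀ k, 0 ≤ k → psibar k v = 0) : v = vacCoeff v • ketVac 0 := by
  refine Finsupp.ext fun m => ?_
  rcases m.eq_vacMaya_zero_or with rfl | ⟨k, hk, hkm⟩ | ⟨k, hk, hkm⟩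
  · simp [vacCoeff, ketVac, ket]
  · have hne : vacMaya 0 ≠ m := by
      rintro rfl
      rw [mem_vacMaya_zero] at hkm
      omega
    have := psibar_psi_self_apply k v m
    rw [h k hk, map_zero, if_pos hkm] at this
    rw [← this]
    simp [ketVac, ket, hne]
  · have hne : vacMaya 0 ≠ m := by
      rintro rfl
      exact hkm (mem_vacMaya_zero.2 hk)
    have hv := psi_psibar k (-k - 1) v
    rw [h' _ (by omega), map_zero, if_pos (by ring), eq_comm, sub_eq_zero] at hv
    have := psibar_psi_self_apply k v m
    rw [← hv, if_neg hkm] at this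
    rw [this]
    simp [ketVac, ket, hne]

/-- An operator commuting with all fermion operators is determined by its value on the vacuum. -/
lemma eq_zero_of_comm_fermions {T : FockF →ₗ[ℂ] FockF}
    (hpsi : ∀ k v, T (psi k v) = psi k (T v)) (hpsibar : ∀ k v, T (psibar k v) = psibar k (T v))
    (hvac : T (ketVac 0) = 0) : T = 0 := by
  have hfin (m : Maya) : {k : ℤ | ¬ (k ∈ m.1 ↔ k < 0)}.Finite := by
    obtain ⟨⟨n₀, h₀⟩, n₁, h₁⟩ := m.2
    refine (Set.finite_Icc (min 0 n₀) (max 0 n₁)).subset fun k hk => ?_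
    by_contra hk'
    rw [Set.mem_Icc] at hk'
    rcases lt_or_ge k (min 0 n₀) with h | h
    · exact hk ⟨fun _ => by omega, fun _ => h₀ k (by omega)⟩
    · exact hk ⟨fun hkm => absurd hkm (h₁ k (by omega)), fun _ => by omega⟩
  refine fock_hom_ext fun m => ?_
  rw [LinearMap.zero_apply]
  induction hd : {k : ℤ | ¬ (k ∈ m.1 ↔ k < 0)}.ncard using Nat.strong_induction_on
    generalizing m with
  | _ d ih =>
  subst hd
  rcases m.eq_vacMaya_zero_or with rfl | ⟨k, hk, hkm⟩ | ⟨k, hk, hkm⟩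
  · exact hvac
  · have hlt := Set.ncard_lt_ncard (s := {l : ℤ | ¬ (l ∈ (mayaErase m k).1 ↔ l < 0)})
      (t := {l : ℤ | ¬ (l ∈ m.1 ↔ l < 0)}) (by
        refine (Set.ssubset_iff_of_subset fun l hl => ?_).2
          ⟨k, fun h => (not_lt.2 hk) (h.1 hkm), fun h => h ?_⟩
        · rcases eq_or_ne l k with rfl | hlk
          · exact fun h => (not_lt.2 hk) (h.1 hkm)
          · simpa [mem_mayaErase, hlk] using hl
        · simp [mem_mayaErase, hk]) (hfin m)
    have hm := psibar_psi_ket_self k m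
    rw [if_pos hkm] at hm
    rw [← hm, hpsibar, psi_ket, if_pos hkm, map_smul, ih _ hlt _ rfl, smul_zero, map_zero]
  · have hlt := Set.ncard_lt_ncard (s := {l : ℤ | ¬ (l ∈ (mayaInsert m k).1 ↔ l < 0)})
      (t := {l : ℤ | ¬ (l ∈ m.1 ↔ l < 0)}) (by
        refine (Set.ssubset_iff_of_subset fun l hl => ?_).2
          ⟨k, fun h => hkm (h.2 hk), fun h => h ?_⟩
        · rcases eq_or_ne l k with rfl | hlk
          · exact fun h => hkm (h.2 hk)
          · simpa [mem_mayaInsert, hlk] using hl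
        · simp [mem_mayaInsert, hk]) (hfin m)
    have hm := psi_psibar_ket_self k m
    have e : -(-k - 1) - 1 = k := by ring
    rw [if_neg hkm] at hm
    rw [← hm, hpsi, psibar_ket, e, if_neg hkm, map_smul, ih _ hlt _ rfl, smul_zero, map_zero]

lemma lterm_ketVac (j : ℚ) {n a : ℤ} (h : ¬ (n ≤ a ∧ a < 0)) :
    lterm j n a (ketVac 0) = 0 := by
  rw [lterm_apply]
  split_ifs with hc
  · rw [psi_ketVac hc.2, map_zero, neg_zero, smul_zero]
  · rw [psibar_ketVac (by omega), map_zero, smul_zero]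

lemma Lop_ketVac_of_nonneg (j : ℚ) {n : ℤ} (hn : 0 ≤ n) : Lop j n (ketVac 0) = 0 := by
  rw [Lop_apply]
  exact finsum_eq_zero_of_forall_eq_zero fun a => lterm_ketVac j (by omega)

lemma Lop_ketVac_of_neg (j : ℚ) {n : ℤ} (hn : n < 0) :
    Lop j n (ketVac 0) =
      ∑ a ∈ Finset.Ico n 0, lcoeff j n a • psi (n - a - 1) (psibar a (ketVac 0)) := by
  rw [Lop_apply, finsum_eq_sum_of_support_subset (s := Finset.Ico n 0)]
  · refine Finset.sum_congr rfl fun a ha => ?_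
    rw [lterm_apply_eq_sub, if_neg (by omega), sub_zero]
  · intro a ha
    rw [Finset.coe_Ico, Set.mem_Ico]
    by_contra hc
    exact ha (lterm_ketVac j hc)

lemma vacCoeff_Lop_of_nonpos (j : ℚ) {n : ℤ} (hn : n ≤ 0) (v : FockF) :
    vacCoeff (Lop j n v) = 0 := by
  rw [Lop_apply, ← LinearMap.toAddMonoidHom_coe, vacCoeff.toAddMonoidHom.map_finsum
    (lterm_support_finite j n v)]
  refine finsum_eq_zero_of_forall_eq_zero fun a => ?_
  rw [LinearMap.toAddMonoidHom_coe, lterm_apply, map_smul]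
  split_ifs with hc
  · rw [map_neg, vacCoeff_psibar hc.1, neg_zero, smul_zero]
  · rcases lt_or_ge (n - a - 1) 0 with h | h
    · rw [vacCoeff_psi h, smul_zero]
    · omega

lemma vacCoeff_Lop_ketVac (j : ℚ) (n : ℤ) : vacCoeff (Lop j n (ketVac 0)) = 0 := by
  rcases le_total n 0 with h | h
  · exact vacCoeff_Lop_of_nonpos j h _
  · rw [Lop_ketVac_of_nonneg j h, map_zero]

lemma vacCoeff_Lop_Lop_ketVac (j : ℚ) (n : ℤ) {m : ℤ} (hm : m < 0) :
    vacCoeff (Lop j n (Lop j m (ketVac 0))) =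
      if n + m = 0 then ∑ a ∈ Finset.Ico m 0, lcoeff j m a * lcoeff j n (a - m) else 0 := by
  have hvac : vacCoeff (ketVac 0) = 1 := by rw [ketVac, vacCoeff_ket, if_pos rfl]
  have key : ∀ a ∈ Finset.Ico m 0,
      vacCoeff (Lop j n (lcoeff j m a • psi (m - a - 1) (psibar a (ketVac 0)))) =
        if n + m = 0 then lcoeff j m a * lcoeff j n (a - m) else 0 := by
    intro a ha
    rw [Finset.mem_Ico] at ha
    rw [map_smul, map_smul, Lop_psi, map_add, vacCoeff_psi (by omega), zero_add, map_smul,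
      psi_psibar, map_sub, vacCoeff_psibar ha.2, sub_zero,
      show -(m - a - 1) - 1 = a - m by ring]
    by_cases h : n + m = 0
    · rw [if_pos h, if_pos (by omega), hvac, smul_eq_mul, smul_eq_mul, mul_one]
    · rw [if_neg h, if_neg (by omega), map_zero, smul_zero, smul_zero]
  rw [Lop_ketVac_of_neg j hm, map_sum, map_sum, Finset.sum_congr rfl key]
  split_ifs <;> simp

lemma sum_range_shift_mul_shift (x y : ℂ) (N : ℕ) :
    ∑ i ∈ Finset.range N, ((i : ℂ) + x) * (i + y) =
      N * (N - 1) * (2 * N - 1) / 6 + (x + y) * (N * (N - 1) / 2) + x * y * N := by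
  induction N with
  | zero => simp
  | succ N ih =>
    rw [Finset.sum_range_succ, ih]
    push_cast
    ring

lemma sum_lcoeff_mul_lcoeff (j : ℚ) (N : ℕ) :
    ∑ a ∈ Finset.Ico (-(N : ℤ)) 0, lcoeff j (-N) a * lcoeff j N (a + N) =
      -((1 / 6 : ℂ) * (6 * j ^ 2 - 6 * j + 1) * ((N : ℂ) ^ 3 - N)) := by
  have h : ∑ a ∈ Finset.Ico (-(N : ℤ)) 0, lcoeff j (-N) a * lcoeff j N (a + N) =
      ∑ i ∈ Finset.range N,
        ((i : ℂ) + j * (1 - N)) * (i + (j - (1 - j) * N)) := by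
    symm
    refine Finset.sum_bij (fun i _ => (i : ℤ) - N) ?_ ?_ ?_ ?_
    · intro i hi
      rw [Finset.mem_range] at hi
      rw [Finset.mem_Ico]
      omega
    · intro i _ i' _ h
      omega
    · intro a ha
      rw [Finset.mem_Ico] at ha
      exact ⟨(a + N).toNat, by rw [Finset.mem_range]; omega, by omega⟩
    · intro i _
      simp only [lcoeff]
      push_cast
      ring
  rw [h, sum_range_shift_mul_shift]
  ring

/-- The central charge, as the vacuum expectation value of the commutator. -/
lemma vacCoeff_commutator_ketVac (j : ℚ) (n m : ℤ) :
    vacCoeff (Lop j n (Lop j m (ketVac 0))) - vacCoeff (Lop j m (Lop j n (ketVac 0))) =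
      -(if n + m = 0 then
        (1 / 6 : ℂ) * (6 * j ^ 2 - 6 * j + 1) * ((n : ℂ) ^ 3 - (n : ℂ)) else 0) := by
  wlog hnm : m ≤ n generalizing n m
  · have := this m n (by omega)
    rw [← neg_sub, this, add_comm m n]
    by_cases h : n + m = 0
    · obtain rfl : m = -n := by omega
      simp only [if_pos h]
      push_cast
      ring
    · simp [h]
  rcases lt_or_ge m 0 with hm | hm
  · rw [vacCoeff_Lop_of_nonpos j hm.le, sub_zero, vacCoeff_Lop_Lop_ketVac j n hm]
    by_cases h : n + m = 0
    · obtain ⟨N, rfl⟩ := Int.eq_ofNat_of_zero_le (show 0 ≤ n by omega)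
      obtain rfl : m = -N := by omega
      rw [if_pos h, if_pos h]
      simpa using sum_lcoeff_mul_lcoeff j N
    · rw [if_neg h, if_neg h, neg_zero]
  · rw [Lop_ketVac_of_nonneg j hm, Lop_ketVac_of_nonneg j (hm.trans hnm), map_zero, map_zero,
      map_zero, map_zero, sub_self, zero_eq_neg]
    by_cases h : n + m = 0
    · obtain rfl : n = 0 := by omega
      simp
    · rw [if_neg h]

/-! ### The commutation relations -/

/-- The failure of the `Lop j n` to satisfy the commutation relations of the Witt algebra. -/
def wittDefect (j : ℚ) (n m : ℤ) : FockF →ₗ[ℂ] FockF :=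
  Lop j n ∘ₗ Lop j m - Lop j m ∘ₗ Lop j n - ((n : ℂ) - m) • Lop j (n + m)

lemma wittDefect_apply (j : ℚ) (n m : ℤ) (v : FockF) :
    wittDefect j n m v =
      Lop j n (Lop j m v) - Lop j m (Lop j n v) - ((n : ℂ) - m) • Lop j (n + m) v :=
  rfl

lemma wittDefect_psi (j : ℚ) (n m k : ℤ) (v : FockF) :
    wittDefect j n m (psi k v) = psi k (wittDefect j n m v) := by
  simp only [wittDefect_apply, Lop_psi, map_add, map_sub, map_smul, ← add_assoc]
  rw [add_comm m n]
  simp only [lcoeff]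
  push_cast
  module

lemma wittDefect_psibar (j : ℚ) (n m k : ℤ) (v : FockF) :
    wittDefect j n m (psibar k v) = psibar k (wittDefect j n m v) := by
  simp only [wittDefect_apply, Lop_psibar, map_sub, map_smul, ← add_assoc]
  rw [add_comm m n]
  simp only [lcoeff]
  push_cast
  module

lemma wittDefect_eq_smul_id (j : ℚ) (n m : ℤ) :
    wittDefect j n m = vacCoeff (wittDefect j n m (ketVac 0)) • LinearMap.id := by
  rw [← sub_eq_zero]
  refine eq_zero_of_comm_fermions (fun k v => ?_) (fun k v => ?_) ?_
  · simp [wittDefect_psi]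
  · simp [wittDefect_psibar]
  · rw [LinearMap.sub_apply, sub_eq_zero]
    refine eq_smul_ketVac (fun k hk => ?_) fun k hk => ?_
    · rw [← wittDefect_psi, psi_ketVac hk, map_zero]
    · rw [← wittDefect_psibar, psibar_ketVac hk, map_zero]

/-- For every `j ∈ (1/2)ℤ` the Virasoro operators on `ℱ`
satisfy `[L_n^{(j)}, L_m^{(j)}] = (n - m) L_{n+m}^{(j)} -
(1/6)(6j² - 6j + 1)(n³ - n) δ_{n+m,0} · id`; i.e. they form a representation of
the Virasoro algebra with central charge `c = -2(6j² - 6j + 1)`. -/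
theorem virasoro_commutation_relations (j : ℚ) (hj : IsHalfIntegral j) (n m : ℤ) :
    Lop j n ∘ₗ Lop j m - Lop j m ∘ₗ Lop j n =
      ((n : ℂ) - (m : ℂ)) • Lop j (n + m) -
        (if n + m = 0 then
          ((1 / 6 : ℂ) * ((6 * j ^ 2 - 6 * j + 1 : ℚ) : ℂ) * ((n : ℂ) ^ 3 - (n : ℂ))) •
            (LinearMap.id : FockF →ₗ[ℂ] FockF)
         else 0) := by
  refine LinearMap.ext fun v => ?_
  have h := LinearMap.congr_fun (wittDefect_eq_smul_id j n m) v
  rw [wittDefect_apply j n m (ketVac 0), map_sub, map_sub, map_smul, vacCoeff_Lop_ketVac,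
    smul_zero, sub_zero, vacCoeff_commutator_ketVac, wittDefect_apply, LinearMap.smul_apply,
    LinearMap.id_apply] at h
  rw [LinearMap.sub_apply, LinearMap.comp_apply, LinearMap.comp_apply, eq_add_of_sub_eq h]
  split_ifs
  · simp only [LinearMap.sub_apply, LinearMap.smul_apply, LinearMap.id_apply]
    push_cast
    module
  · simp only [LinearMap.sub_apply, LinearMap.smul_apply, LinearMap.zero_apply]
    module

end AbCFT
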